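/- For every bilinear form φ on V with φ(Jx,Jy) = φ(x,y) for all x,y, with Σᵢ φ(eᵢ,eᵢ) = 0, and with Σᵢ φ(eᵢ,Jeᵢ) = 0 (i.e., φ ∈ S²₀₊ ⊕ Λ²₀₊), the operator ϑφ belongs to K₊: ϑφ is an affine curvature operator, commutes with J, and satisfies (ϑφ)(Jx,Jy) = (ϑφ)(x,y) for all x,y. -/

import Mathlib

open Module
open scoped RealInnerProductSpace

variable {V : Type*} [NormedAddCommGroup V] [InnerProductSpace ℝ V] [FiniteDimensional ℝ V]

/-- `A` is an affine curvature operator. -/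
def IsAff (A : V →ₗ[ℝ] V →ₗ[ℝ] V →ₗ[ℝ] V) : Prop :=
  (∀ x y, A x y = - A y x) ∧ ∀ x y z, A x y z + A y z x + A z x y = 0

/-- `A` is an affine Kähler curvature operator: `A ∈ 𝔄` and `A(x,y)` commutes with `J`. -/
def IsK (J : V →ₗ[ℝ] V) (A : V →ₗ[ℝ] V →ₗ[ℝ] V →ₗ[ℝ] V) : Prop :=
  IsAff A ∧ ∀ x y z, A x y (J z) = J (A x y z)

/-- `A ∈ K₊`. -/
def IsKplus (J : V →ₗ[ℝ] V) (A : V →ₗ[ℝ] V →ₗ[ℝ] V →ₗ[ℝ] V) : Prop :=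
  IsK J A ∧ ∀ x y, A (J x) (J y) = A x y

/-- for `φ ∈ S²₀₊ ⊕ Λ²₀₊`, the operator `ϑφ`, determined by
`⟨(ϑφ)(x,y)z, w⟩ = φ(x,w)⟨y,z⟩ − φ(y,w)⟨x,z⟩ + φ(x,Jw)⟨y,Jz⟩ − φ(y,Jw)⟨x,Jz⟩ − 2φ(z,Jw)⟨x,Jy⟩`,
belongs to `K₊`. -/
theorem statement10 {m : ℕ} (e : OrthonormalBasis (Fin m) ℝ V)
    (J : V →ₗ[ℝ] V) (hJ : ∀ v, J (J v) = -v)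
    (hJinner : ∀ x y : V, ⟪J x, J y⟫ = ⟪x, y⟫)
    (φ : V →ₗ[ℝ] V →ₗ[ℝ] ℝ) (hJφ : ∀ x y, φ (J x) (J y) = φ x y)
    (htr : ∑ i, φ (e i) (e i) = 0) (htrJ : ∑ i, φ (e i) (J (e i)) = 0)
    (T : V →ₗ[ℝ] V →ₗ[ℝ] V →ₗ[ℝ] V)
    (hT : ∀ x y z w : V, ⟪T x y z, w⟫ =
      φ x w * ⟪y, z⟫ - φ y w * ⟪x, z⟫ + φ x (J w) * ⟪y, J z⟫ - φ y (J w) * ⟪x, J z⟫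
        - 2 * φ z (J w) * ⟪x, J y⟫) :
    IsKplus J T := by
  have hs : ∀ x y : V, ⟪J x, y⟫ = -⟪x, J y⟫ := by
    intro x y
    have h := hJinner x (J y)
    rw [hJ, inner_neg_right] at h
    linarith
  have hsw : ∀ x y : V, ⟪x, J y⟫ = -⟪y, J x⟫ := by
    intro x y
    rw [← hs y x, real_inner_comm]
  have hp : ∀ x y : V, φ (J x) y = -φ x (J y) := by
    intro x y
    have h := hJφ x (J y)
    rw [hJ, map_neg] at h
    linarith
  refine ⟨⟨⟨?_, ?_⟩, ?_⟩, ?_⟩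
  · intro x y
    ext z
    refine ext_inner_right ℝ fun w => ?_
    rw [LinearMap.neg_apply, inner_neg_left, hT, hT, hsw y x]
    ring
  · intro x y z
    refine ext_inner_right ℝ fun w => ?_
    rw [inner_add_left, inner_add_left, inner_zero_left, hT, hT, hT,
      real_inner_comm y z, real_inner_comm x z, real_inner_comm x y,
      hsw z y, hsw z x, hsw y x]
    ring
  · intro x y z
    refine ext_inner_right ℝ fun w => ?_
    rw [hs, hT, hT]
    simp only [hJ, hJφ, map_neg, inner_neg_right]
    ring
  · intro x y
    ext z
    refine ext_inner_right ℝ fun w => ?_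
    rw [hT, hT]
    simp only [hJφ, hJinner, hp, hs, hJ, map_neg, inner_neg_right]
    ring
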